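/- arXiv:2405.10360 — 2 statements merged into one kernel-verified Lean document; each statement's English description precedes it below -/
import Mathlib

section
/- Let d ≥ 1, let μ be the Haar probability measure on the compact group U(d) of d×d complex unitary matrices, fix a unit vector ψ₀ ∈ ℂ^d, and let A, B ∈ M_d(ℂ). Then ∫_{U(d)} ⟨Vψ₀, A Vψ₀⟩ · ⟨Vψ₀, B Vψ₀⟩ dμ(V) = (tr(A)·tr(B) + tr(A B)) / (d·(d+1)). -/
open Matrix MeasureTheory

theorem Matrix.isCompact_unitaryGroup (n : Type*) [Fintype n] [DecidableEq n] :
    IsCompact (Matrix.unitaryGroup n ℂ : Set (Matrix n n ℂ)) := by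
  have hball : IsCompact
      (Set.univ.pi fun _ => Set.univ.pi fun _ => Metric.closedBall 0 1 : Set (n → n → ℂ)) :=
    isCompact_univ_pi fun _ => isCompact_univ_pi fun _ => isCompact_closedBall _ _
  have hclosed : IsClosed {U : Matrix n n ℂ | U * star U = 1} :=
    isClosed_eq (continuous_id.mul continuous_id.matrix_conjTranspose) continuous_const
  have heq : (Matrix.unitaryGroup n ℂ : Set (Matrix n n ℂ)) = {U | U * star U = 1} :=
    Set.ext fun _ => mem_unitaryGroup_iff
  rw [← heq] at hclosed
  refine hball.of_isClosed_subset hclosed fun U hU i _ j _ => ?_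
  simpa using entry_norm_bound_of_unitary hU i j

instance Matrix.compactSpace_unitaryGroup (n : Type*) [Fintype n] [DecidableEq n] :
    CompactSpace (Matrix.unitaryGroup n ℂ) :=
  isCompact_iff_compactSpace.mp (Matrix.isCompact_unitaryGroup n)

theorem Matrix.diagonal_mem_unitaryGroup {n : Type*} [Fintype n] [DecidableEq n] {φ : n → ℂ}
    (hφ : ∀ i, φ i * star (φ i) = 1) : diagonal φ ∈ Matrix.unitaryGroup n ℂ := by
  rw [mem_unitaryGroup_iff, star_eq_conjTranspose, diagonal_conjTranspose, diagonal_mul_diagonal,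
    ← diagonal_one]
  exact congrArg diagonal (funext hφ)

/-- The complex reflection acting as multiplication by `I` on the span of `eᵢ - eⱼ` and as the
identity on its orthogonal complement. -/
noncomputable def complexReflection {n : Type*} [DecidableEq n] (i j : n) : Matrix n n ℂ :=
  1 - ((1 - Complex.I) / 2) •
    vecMulVec (Pi.single i 1 - Pi.single j 1) (Pi.single i 1 - Pi.single j 1)

theorem complexReflection_mem_unitaryGroup {n : Type*} [Fintype n] [DecidableEq n] {i j : n}
    (hij : i ≠ j) : complexReflection i j ∈ Matrix.unitaryGroup n ℂ := by
  have hv : star (Pi.single i 1 - Pi.single j 1 : n → ℂ) = Pi.single i 1 - Pi.single j 1 := by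
    simp
  have hP : (vecMulVec (Pi.single i 1 - Pi.single j 1) (Pi.single i 1 - Pi.single j 1) *
      vecMulVec (Pi.single i 1 - Pi.single j 1) (Pi.single i 1 - Pi.single j 1) : Matrix n n ℂ) =
      (2 : ℂ) • vecMulVec (Pi.single i 1 - Pi.single j 1) (Pi.single i 1 - Pi.single j 1) := by
    rw [vecMulVec_mul_vecMulVec]
    simp [hij, hij.symm]
    norm_num
  rw [mem_unitaryGroup_iff, star_eq_conjTranspose, complexReflection, conjTranspose_sub,
    conjTranspose_one, conjTranspose_smul, conjTranspose_vecMulVec, hv]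
  simp only [sub_mul, mul_sub, one_mul, mul_one, smul_mul_smul_comm, hP]
  match_scalars
  · norm_num
  · simp
    linear_combination (-1 / 2) * Complex.I_sq

theorem complexReflection_mulVec_left {n : Type*} [Fintype n] [DecidableEq n] {i j : n}
    (hij : i ≠ j) (x : n → ℂ) :
    (complexReflection i j *ᵥ x) i = ((1 + Complex.I) * x i + (1 - Complex.I) * x j) / 2 := by
  simp [complexReflection, sub_mulVec, smul_mulVec, vecMulVec_mulVec, sub_dotProduct, hij]
  ring

/-- The monomial `x ↦ conj xᵢ * xⱼ * conj xₖ * xₗ` as a continuous function. -/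
def quarticMonomial {n : Type*} (i j k l : n) : C(n → ℂ, ℂ) where
  toFun x := star (x i) * x j * star (x k) * x l

theorem quarticMonomial_apply {n : Type*} (i j k l : n) (x : n → ℂ) :
    quarticMonomial i j k l x = star (x i) * x j * star (x k) * x l := rfl

theorem quarticMonomial_swap {n : Type*} (i j k l : n) :
    quarticMonomial i j k l = quarticMonomial i l k j := by
  ext x
  simp only [quarticMonomial_apply]
  ring

theorem quarticMonomial_comm {n : Type*} (i j k l : n) :
    quarticMonomial i j k l = quarticMonomial k l i j := by
  ext x
  simp only [quarticMonomial_apply]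
  ring

/-- A functional on continuous functions that is invariant under unitary changes of variable. -/
def UnitarilyInvariant {n : Type*} [Fintype n] [DecidableEq n]
    (L : C(n → ℂ, ℂ) →ₗ[ℂ] ℂ) : Prop :=
  ∀ U ∈ Matrix.unitaryGroup n ℂ, ∀ f g : C(n → ℂ, ℂ), (∀ x, g x = f (U *ᵥ x)) → L g = L f

namespace UnitarilyInvariant

variable {n : Type*} [Fintype n] [DecidableEq n] {L : C(n → ℂ, ℂ) →ₗ[ℂ] ℂ}

theorem moment_eq_zero_of_phase (hL : UnitarilyInvariant L) {i j k l : n} {φ : n → ℂ}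
    (hφ : ∀ i, φ i * star (φ i) = 1) (hne : star (φ i) * φ j * star (φ k) * φ l ≠ 1) :
    L (quarticMonomial i j k l) = 0 := by
  have h := hL _ (diagonal_mem_unitaryGroup hφ) (quarticMonomial i j k l)
    ((star (φ i) * φ j * star (φ k) * φ l) • quarticMonomial i j k l) fun x => by
      simp only [ContinuousMap.smul_apply, quarticMonomial_apply, mulVec_diagonal, star_mul',
        smul_eq_mul]
      ring
  rw [map_smul, smul_eq_mul] at h
  exact (mul_left_eq_self₀.mp h).resolve_left hne

theorem moment_eq_zero (hL : UnitarilyInvariant L) {i j k l : n}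
    (h₁ : ¬(i = j ∧ k = l)) (h₂ : ¬(i = l ∧ k = j)) : L (quarticMonomial i j k l) = 0 := by
  have hI : (-1 : ℂ) ≠ 1 := by norm_num
  have hnegI : -Complex.I ≠ 1 := fun h => by simpa using congrArg Complex.re h
  have hφ : ∀ p q : n, (if q = p then Complex.I else 1) *
      star (if q = p then Complex.I else 1) = 1 := by
    intro p q
    split_ifs <;> simp
  by_cases hij : i = j
  · subst hij
    have hkl : k ≠ l := fun h => h₁ ⟨rfl, h⟩
    refine hL.moment_eq_zero_of_phase (φ := fun q => if q = k then Complex.I else 1) (hφ k) ?_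
    by_cases hik : i = k <;> simp [hik, hkl.symm, hnegI]
  by_cases hil : i = l
  · subst hil
    have hkj : k ≠ j := fun h => h₂ ⟨rfl, h⟩
    refine hL.moment_eq_zero_of_phase (φ := fun q => if q = k then Complex.I else 1) (hφ k) ?_
    by_cases hik : i = k <;> simp [hik, hkj.symm, hnegI]
  refine hL.moment_eq_zero_of_phase (φ := fun q => if q = i then Complex.I else 1) (hφ i) ?_
  by_cases hik : k = i <;> simp [hik, Ne.symm hij, Ne.symm hil, hI, hnegI]

theorem four_mul_moment_self (hL : UnitarilyInvariant L) {i j : n} (hij : i ≠ j) :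
    4 * L (quarticMonomial i i i i) =
      L (quarticMonomial i i i i) + L (quarticMonomial j j j j) +
        4 * L (quarticMonomial i i j j) := by
  have h := hL _ (complexReflection_mem_unitaryGroup hij) ((4 : ℂ) • quarticMonomial i i i i)
    (quarticMonomial i i i i + quarticMonomial j j j j + (4 : ℂ) • quarticMonomial i i j j
      - quarticMonomial i j i j - quarticMonomial j i j i
      - (2 * Complex.I) • quarticMonomial i i i j + (2 * Complex.I) • quarticMonomial i i j i
      - (2 * Complex.I) • quarticMonomial j j i j + (2 * Complex.I) • quarticMonomial j j j i)
    fun x => by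
      simp only [ContinuousMap.add_apply, ContinuousMap.sub_apply, ContinuousMap.smul_apply,
        quarticMonomial_apply, complexReflection_mulVec_left hij, smul_eq_mul]
      simp only [Complex.star_def, map_div₀, map_add, map_mul, map_sub, map_one, Complex.conj_I,
        map_ofNat]
      have hn : (((1 + -Complex.I) * (starRingEnd ℂ) (x i) +
            (1 - -Complex.I) * (starRingEnd ℂ) (x j)) / 2) *
          (((1 + Complex.I) * x i + (1 - Complex.I) * x j) / 2) =
          (starRingEnd ℂ (x i) * x i + starRingEnd ℂ (x j) * x j
            - Complex.I * (starRingEnd ℂ (x i) * x j)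
            + Complex.I * (starRingEnd ℂ (x j) * x i)) / 2 := by
        linear_combination (-starRingEnd ℂ (x i) * x i - starRingEnd ℂ (x j) * x j
            + starRingEnd ℂ (x i) * x j + starRingEnd ℂ (x j) * x i) / 4 * Complex.I_sq
      rw [mul_assoc _ (_ / 2) (_ / 2), hn]
      linear_combination (-(starRingEnd ℂ (x i) * x j - starRingEnd ℂ (x j) * x i) ^ 2)
        * Complex.I_sq
  simp only [map_add, map_sub, map_smul, smul_eq_mul] at h
  rw [hL.moment_eq_zero (i := i) (j := j) (k := i) (l := j) (by tauto) (by tauto),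
    hL.moment_eq_zero (i := j) (j := i) (k := j) (l := i) (by tauto) (by tauto),
    hL.moment_eq_zero (i := i) (j := i) (k := i) (l := j) (by tauto) (by tauto),
    hL.moment_eq_zero (i := i) (j := i) (k := j) (l := i) (by tauto) (by tauto),
    hL.moment_eq_zero (i := j) (j := j) (k := i) (l := j) (by tauto) (by tauto),
    hL.moment_eq_zero (i := j) (j := j) (k := j) (l := i) (by tauto) (by tauto)] at h
  linear_combination -h

theorem moment_self (hL : UnitarilyInvariant L) (i j : n) :
    L (quarticMonomial i i i i) = L (quarticMonomial j j j j) := by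
  by_cases hij : i = j
  · rw [hij]
  · have h₁ := hL.four_mul_moment_self hij
    have h₂ := hL.four_mul_moment_self (Ne.symm hij)
    rw [quarticMonomial_comm j j i i] at h₂
    linear_combination (h₁ - h₂) / 4

theorem moment_eq (hL : UnitarilyInvariant L) (p i j k l : n) :
    L (quarticMonomial i j k l) = L (quarticMonomial p p p p) / 2 *
      ((if i = j ∧ k = l then 1 else 0) + (if i = l ∧ k = j then 1 else 0)) := by
  have hne : ∀ {a b : n}, a ≠ b →
      L (quarticMonomial a a b b) = L (quarticMonomial p p p p) / 2 := by
    intro a b hab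
    have h := hL.four_mul_moment_self hab
    rw [hL.moment_self b a, hL.moment_self a p] at h
    linear_combination -h / 4
  by_cases h₁ : i = j ∧ k = l
  · obtain ⟨rfl, rfl⟩ := h₁
    by_cases hik : i = k
    · subst hik
      rw [hL.moment_self i p]
      simp
      ring
    · simp [hne hik, hik]
  by_cases h₂ : i = l ∧ k = j
  · obtain ⟨rfl, rfl⟩ := h₂
    have hik : i ≠ k := fun h => h₁ ⟨h, h.symm⟩
    rw [quarticMonomial_swap, hne hik]
    simp [hik]
  · simp [hL.moment_eq_zero h₁ h₂, h₁, h₂]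

/-- The quartic moments of a unitarily invariant functional supported on the unit sphere. -/
theorem moment_eq_div (hL : UnitarilyInvariant L)
    (hone : ∑ i, ∑ k, L (quarticMonomial i i k k) = 1) (i j k l : n) :
    L (quarticMonomial i j k l) =
      ((if i = j ∧ k = l then 1 else 0) + (if i = l ∧ k = j then 1 else 0)) /
        ((Fintype.card n : ℂ) * ((Fintype.card n : ℂ) + 1)) := by
  have hsum : ∑ a : n, ∑ b : n, L (quarticMonomial a a b b) =
      L (quarticMonomial i i i i) / 2 * (Fintype.card n * (Fintype.card n + 1)) := by
    rw [Finset.sum_congr rfl fun a _ => Finset.sum_congr rfl fun b _ => hL.moment_eq i a a b b]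
    simp_rw [← Finset.mul_sum, Finset.sum_add_distrib]
    congr 1
    have : ∀ a b : n, (a = b ∧ b = a) ↔ a = b := fun a b => ⟨And.left, fun h => ⟨h, h.symm⟩⟩
    simp only [this, and_self, if_true, Finset.sum_const, Finset.card_univ, nsmul_eq_mul,
      Finset.sum_ite_eq, Finset.mem_univ, mul_one]
    ring
  rw [hone] at hsum
  rw [hL.moment_eq i, eq_div_iff (right_ne_zero_of_mul (hsum ▸ one_ne_zero))]
  linear_combination
    -((if i = j ∧ k = l then 1 else 0) + (if i = l ∧ k = j then 1 else 0) : ℂ) * hsum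

end UnitarilyInvariant

section HaarFunctional

variable {n : Type*} [Fintype n] [DecidableEq n]
  [MeasurableSpace (Matrix.unitaryGroup n ℂ)] [BorelSpace (Matrix.unitaryGroup n ℂ)]

theorem integrable_comp_unitary_mulVec (μ : Measure (Matrix.unitaryGroup n ℂ))
    [IsFiniteMeasureOnCompacts μ] (ψ : n → ℂ) (f : C(n → ℂ, ℂ)) :
    Integrable (fun V : Matrix.unitaryGroup n ℂ => f ((V : Matrix n n ℂ) *ᵥ ψ)) μ := by
  have hc : Continuous fun V : Matrix.unitaryGroup n ℂ => f ((V : Matrix n n ℂ) *ᵥ ψ) :=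
    f.continuous.comp (continuous_subtype_val.matrix_mulVec continuous_const)
  exact hc.integrable_of_hasCompactSupport (HasCompactSupport.of_compactSpace _)

/-- The functional `f ↦ ∫ f (V ψ) dμ(V)`. -/
noncomputable def orbitIntegral (μ : Measure (Matrix.unitaryGroup n ℂ))
    [IsFiniteMeasureOnCompacts μ] (ψ : n → ℂ) : C(n → ℂ, ℂ) →ₗ[ℂ] ℂ where
  toFun f := ∫ V : Matrix.unitaryGroup n ℂ, f ((V : Matrix n n ℂ) *ᵥ ψ) ∂μ
  map_add' f g := integral_add (integrable_comp_unitary_mulVec μ ψ f)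
    (integrable_comp_unitary_mulVec μ ψ g)
  map_smul' c _ := integral_const_mul c _

theorem orbitIntegral_apply (μ : Measure (Matrix.unitaryGroup n ℂ))
    [IsFiniteMeasureOnCompacts μ] (ψ : n → ℂ) (f : C(n → ℂ, ℂ)) :
    orbitIntegral μ ψ f = ∫ V : Matrix.unitaryGroup n ℂ, f ((V : Matrix n n ℂ) *ᵥ ψ) ∂μ := rfl

theorem unitarilyInvariant_orbitIntegral (μ : Measure (Matrix.unitaryGroup n ℂ))
    [IsFiniteMeasureOnCompacts μ] [μ.IsMulLeftInvariant] (ψ : n → ℂ) :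
    UnitarilyInvariant (orbitIntegral μ ψ) := by
  intro U hU f g hfg
  rw [orbitIntegral_apply, orbitIntegral_apply,
    ← integral_mul_left_eq_self (fun V : Matrix.unitaryGroup n ℂ => f ((V : Matrix n n ℂ) *ᵥ ψ)) ⟨U, hU⟩]
  simp [hfg, mulVec_mulVec]

theorem orbitIntegral_sum_quarticMonomial (μ : Measure (Matrix.unitaryGroup n ℂ))
    [IsFiniteMeasureOnCompacts μ] [IsProbabilityMeasure μ] {ψ : n → ℂ} (hψ : star ψ ⬝ᵥ ψ = 1) :
    ∑ i, ∑ k, orbitIntegral μ ψ (quarticMonomial i i k k) = 1 := by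
  have hnorm : ∀ V : Matrix.unitaryGroup n ℂ,
      ∑ i, star (((V : Matrix n n ℂ) *ᵥ ψ) i) * ((V : Matrix n n ℂ) *ᵥ ψ) i = 1 := by
    intro V
    change star ((V : Matrix n n ℂ) *ᵥ ψ) ⬝ᵥ ((V : Matrix n n ℂ) *ᵥ ψ) = 1
    rw [star_mulVec, ← dotProduct_mulVec, mulVec_mulVec, ← star_eq_conjTranspose,
      mem_unitaryGroup_iff'.mp V.2, one_mulVec, hψ]
  simp_rw [← map_sum, orbitIntegral_apply, ContinuousMap.sum_apply, quarticMonomial_apply,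
    mul_assoc (star _ * _), ← Finset.mul_sum, hnorm, mul_one, hnorm]
  simp

end HaarFunctional

/-- The second-moment formula for Haar-random pure states:
`∫ ⟨Vψ₀, A Vψ₀⟩ ⟨Vψ₀, B Vψ₀⟩ dμ(V) = (tr(A) tr(B) + tr(AB)) / (d (d+1))`. -/
theorem stmt8 {d : ℕ} (hd : 1 ≤ d)
    [MeasurableSpace (Matrix.unitaryGroup (Fin d) ℂ)]
    [BorelSpace (Matrix.unitaryGroup (Fin d) ℂ)]
    (μ : Measure (Matrix.unitaryGroup (Fin d) ℂ))
    [μ.IsHaarMeasure] [IsProbabilityMeasure μ]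
    (ψ₀ : Fin d → ℂ) (hψ₀ : star ψ₀ ⬝ᵥ ψ₀ = 1)
    (A B : Matrix (Fin d) (Fin d) ℂ) :
    ∫ V : Matrix.unitaryGroup (Fin d) ℂ,
        (star ((V : Matrix (Fin d) (Fin d) ℂ).mulVec ψ₀) ⬝ᵥ
            A.mulVec ((V : Matrix (Fin d) (Fin d) ℂ).mulVec ψ₀)) *
          (star ((V : Matrix (Fin d) (Fin d) ℂ).mulVec ψ₀) ⬝ᵥ
            B.mulVec ((V : Matrix (Fin d) (Fin d) ℂ).mulVec ψ₀)) ∂μ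
      = (A.trace * B.trace + (A * B).trace) / ((d : ℂ) * ((d : ℂ) + 1)) := by
  have hL := (unitarilyInvariant_orbitIntegral μ ψ₀).moment_eq_div
    (orbitIntegral_sum_quarticMonomial μ hψ₀)
  have hexp : ∀ x : Fin d → ℂ, (star x ⬝ᵥ A *ᵥ x) * (star x ⬝ᵥ B *ᵥ x) =
      (∑ k, ∑ l, ∑ i, ∑ j, (A i j * B k l) • quarticMonomial i j k l : C(Fin d → ℂ, ℂ)) x := by
    intro x
    simp only [ContinuousMap.sum_apply, ContinuousMap.smul_apply, quarticMonomial_apply,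
      dotProduct, mulVec, Finset.mul_sum, Finset.sum_mul, Pi.star_apply, smul_eq_mul]
    refine Finset.sum_congr rfl fun k _ => Finset.sum_congr rfl fun l _ =>
      Finset.sum_congr rfl fun i _ => Finset.sum_congr rfl fun j _ => ?_
    ring
  simp_rw [hexp]
  rw [← orbitIntegral_apply]
  simp only [map_sum, map_smul, hL, smul_eq_mul, Fintype.card_fin, ← mul_div_assoc,
    ← Finset.sum_div]
  congr 1
  simp only [mul_add, Finset.sum_add_distrib, mul_ite, mul_one, mul_zero, ite_and]
  simp only [Finset.sum_ite_eq, Finset.sum_ite_eq', Finset.sum_const_zero, Finset.mem_univ,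
    Finset.sum_ite_irrel, if_true, trace, diag_apply, mul_apply, Finset.sum_mul_sum]
  exact congrArg₂ (· + ·) Finset.sum_comm Finset.sum_comm
end

section
/- Let d ≥ 2, let μ be the Haar probability measure on the compact group U(d) of d×d complex unitary matrices, fix a unit vector ψ₀ ∈ ℂ^d, let A ∈ M_d(ℂ) be Hermitian with tr(A) = 0 and A² = 1, and let W ∈ M_d(ℂ) be unitary. Then ∫_{U(d)} ( ⟨Vψ₀, (A − W* A W) Vψ₀⟩ )² dμ(V) = (2/(d+1)) · (1 − Re(tr(A W* A W))/d). -/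
open Matrix MeasureTheory

section UnitaryMoments

variable {d : ℕ}

theorem sum_normSq_unitary_mulVec (V : Matrix.unitaryGroup (Fin d) ℂ) {ψ : Fin d → ℂ}
    (hψ : star ψ ⬝ᵥ ψ = 1) :
    ∑ i, Complex.normSq (((V : Matrix (Fin d) (Fin d) ℂ) *ᵥ ψ) i) = 1 := by
  have h : star ((V : Matrix (Fin d) (Fin d) ℂ) *ᵥ ψ) ⬝ᵥ ((V : Matrix (Fin d) (Fin d) ℂ) *ᵥ ψ) = 1 := by
    rw [star_mulVec, ← dotProduct_mulVec, mulVec_mulVec, ← star_eq_conjTranspose,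
      Unitary.coe_star_mul_self, one_mulVec, hψ]
  apply Complex.ofReal_injective
  rw [Complex.ofReal_one, ← h, dotProduct, Complex.ofReal_sum]
  exact Finset.sum_congr rfl fun i _ => by simp [Complex.normSq_eq_conj_mul_self]

/-- Every unit vector is a row of a unitary matrix. -/
theorem exists_mem_unitaryGroup_row_eq (i : Fin d) {w : Fin d → ℂ} (hw : star w ⬝ᵥ w = 1) :
    ∃ U ∈ Matrix.unitaryGroup (Fin d) ℂ, U i = w := by
  have hv : Orthonormal ℂ (({i} : Set (Fin d)).domRestrict
      fun _ => (WithLp.toLp 2 w : EuclideanSpace ℂ (Fin d))) := by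
    rw [orthonormal_iff_ite]
    rintro ⟨a, rfl⟩ ⟨b, rfl⟩
    rw [if_pos rfl]
    exact (EuclideanSpace.inner_toLp_toLp w w).trans ((dotProduct_comm _ _).trans hw)
  obtain ⟨b, hb⟩ := hv.exists_orthonormalBasis_extension_of_card_eq (by simp)
  refine ⟨((EuclideanSpace.basisFun (Fin d) ℂ).toBasis.toMatrix b)ᵀ, ?_, ?_⟩
  · have h := congrArg transpose
      ((EuclideanSpace.basisFun (Fin d) ℂ).toMatrix_orthonormalBasis_conjTranspose_mul_self b)
    rw [transpose_mul, transpose_one] at h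
    exact mem_unitaryGroup_iff.2 h
  · ext j
    simp [Module.Basis.toMatrix_apply, hb i rfl]

theorem sum_sum_mul_ite_half (c : ℝ) (l : Fin d → ℝ) :
    ∑ i, ∑ j, l i * l j * ((if i = j then 1 else 1 / 2) * c) =
      c / 2 * ((∑ i, l i) ^ 2 + ∑ i, l i ^ 2) := by
  have h : ∀ i j, l i * l j * ((if i = j then 1 else 1 / 2) * c) =
      c / 2 * (l i * l j + if i = j then l i * l j else 0) := fun i j => by
    split_ifs <;> ring
  simp_rw [h, ← Finset.mul_sum, Finset.sum_add_distrib, ← Finset.mul_sum]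
  simp [sq, Finset.sum_mul]

variable [MeasurableSpace (Matrix.unitaryGroup (Fin d) ℂ)]
    [BorelSpace (Matrix.unitaryGroup (Fin d) ℂ)]
    (μ : Measure (Matrix.unitaryGroup (Fin d) ℂ))

theorem integrable_comp_unitary_mulVec_s9 [IsFiniteMeasure μ] {ψ : Fin d → ℂ}
    (hψ : star ψ ⬝ᵥ ψ = 1) {g : (Fin d → ℂ) → ℝ} (hg : Continuous g) :
    Integrable (fun V : Matrix.unitaryGroup (Fin d) ℂ =>
      g ((V : Matrix (Fin d) (Fin d) ℂ) *ᵥ ψ)) μ := by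
  obtain ⟨C, hC⟩ := (isCompact_closedBall (0 : Fin d → ℂ) 1).exists_bound_of_continuousOn
    hg.continuousOn
  refine Integrable.of_bound (C := C) ?_ (ae_of_all _ fun V => hC _ ?_)
  · exact (hg.comp (continuous_subtype_val.matrix_mulVec continuous_const)).aestronglyMeasurable
  · rw [mem_closedBall_zero_iff, pi_norm_le_iff_of_nonneg zero_le_one]
    intro i
    have h := Finset.single_le_sum (f := fun i => Complex.normSq (((V : Matrix (Fin d) (Fin d) ℂ) *ᵥ ψ) i))
      (fun j _ => Complex.normSq_nonneg _) (Finset.mem_univ i)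
    rw [sum_normSq_unitary_mulVec V hψ, Complex.normSq_eq_norm_sq] at h
    exact (sq_le_one_iff₀ (norm_nonneg _)).1 h

theorem integral_comp_unitary_mulVec_mulVec [μ.IsMulLeftInvariant] (ψ : Fin d → ℂ)
    (g : (Fin d → ℂ) → ℝ) {U : Matrix (Fin d) (Fin d) ℂ} (hU : U ∈ Matrix.unitaryGroup (Fin d) ℂ) :
    ∫ V : Matrix.unitaryGroup (Fin d) ℂ, g (U *ᵥ ((V : Matrix (Fin d) (Fin d) ℂ) *ᵥ ψ)) ∂μ =
      ∫ V : Matrix.unitaryGroup (Fin d) ℂ, g ((V : Matrix (Fin d) (Fin d) ℂ) *ᵥ ψ) ∂μ := by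
  rw [← integral_mul_left_eq_self (fun V : Matrix.unitaryGroup (Fin d) ℂ =>
    g ((V : Matrix (Fin d) (Fin d) ℂ) *ᵥ ψ)) (⟨U, hU⟩ : Matrix.unitaryGroup (Fin d) ℂ)]
  simp [mulVec_mulVec]

theorem integral_normSq_dotProduct_sq [μ.IsMulLeftInvariant] (ψ : Fin d → ℂ) (i : Fin d)
    {w : Fin d → ℂ} {r : ℝ} (hr : 0 < r) (hw : star w ⬝ᵥ w = (r : ℂ)) :
    ∫ V : Matrix.unitaryGroup (Fin d) ℂ,
        Complex.normSq (w ⬝ᵥ (V : Matrix (Fin d) (Fin d) ℂ) *ᵥ ψ) ^ 2 ∂μ =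
      r ^ 2 * ∫ V : Matrix.unitaryGroup (Fin d) ℂ,
        Complex.normSq (((V : Matrix (Fin d) (Fin d) ℂ) *ᵥ ψ) i) ^ 2 ∂μ := by
  have hs : ((√r : ℝ) : ℂ) * (√r : ℝ) = r := by
    rw [← Complex.ofReal_mul, Real.mul_self_sqrt hr.le]
  have hs0 : ((√r : ℝ) : ℂ) ≠ 0 := by simpa using (Real.sqrt_pos.2 hr).ne'
  have hw' : star (((√r : ℝ) : ℂ)⁻¹ • w) ⬝ᵥ (((√r : ℝ) : ℂ)⁻¹ • w) = 1 := by
    rw [star_smul, smul_dotProduct, dotProduct_smul, hw, ← hs]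
    simp [hs0]
  obtain ⟨U, hU, hUi⟩ := exists_mem_unitaryGroup_row_eq i hw'
  rw [← integral_comp_unitary_mulVec_mulVec μ ψ (fun φ => Complex.normSq (φ i) ^ 2) hU,
    ← integral_const_mul]
  congr 1 with V
  have h : ∀ φ : Fin d → ℂ, (U *ᵥ φ) i = ((√r : ℝ) : ℂ)⁻¹ * (w ⬝ᵥ φ) := fun φ => by
    rw [mulVec, hUi, smul_dotProduct, smul_eq_mul]
  rw [h, Complex.normSq_mul, Complex.normSq_inv, Complex.normSq_ofReal, Real.mul_self_sqrt hr.le]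
  field_simp

theorem integral_normSq_mul_normSq [μ.IsMulLeftInvariant] [IsFiniteMeasure μ] {ψ : Fin d → ℂ}
    (hψ : star ψ ⬝ᵥ ψ = 1) (k i j : Fin d) :
    ∫ V : Matrix.unitaryGroup (Fin d) ℂ,
        Complex.normSq (((V : Matrix (Fin d) (Fin d) ℂ) *ᵥ ψ) i) *
          Complex.normSq (((V : Matrix (Fin d) (Fin d) ℂ) *ᵥ ψ) j) ∂μ =
      (if i = j then 1 else 1 / 2) * ∫ V : Matrix.unitaryGroup (Fin d) ℂ,
        Complex.normSq (((V : Matrix (Fin d) (Fin d) ℂ) *ᵥ ψ) k) ^ 2 ∂μ := by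
  set c := ∫ V : Matrix.unitaryGroup (Fin d) ℂ,
        Complex.normSq (((V : Matrix (Fin d) (Fin d) ℂ) *ᵥ ψ) k) ^ 2 ∂μ with hc
  have hdiag : ∀ l : Fin d, ∫ V : Matrix.unitaryGroup (Fin d) ℂ,
      Complex.normSq (((V : Matrix (Fin d) (Fin d) ℂ) *ᵥ ψ) l) ^ 2 ∂μ = c := fun l => by
    have := integral_normSq_dotProduct_sq μ ψ k (w := Pi.single l 1) one_pos (by simp [Pi.star_single])
    simpa using this
  split_ifs with hij
  · subst hij
    simpa [sq] using hdiag i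
  have hpol : ∀ u : ℂ, star u * u = 1 → ∫ V : Matrix.unitaryGroup (Fin d) ℂ,
      Complex.normSq (((V : Matrix (Fin d) (Fin d) ℂ) *ᵥ ψ) i +
        u * ((V : Matrix (Fin d) (Fin d) ℂ) *ᵥ ψ) j) ^ 2 ∂μ = 4 * c := fun u hu => by
    have := integral_normSq_dotProduct_sq μ ψ k (w := Pi.single i 1 + Pi.single j u) two_pos
      (by
        have hu' : (starRingEnd ℂ) u * u = 1 := hu
        simp [Pi.star_single, hij, Ne.symm hij, hu']
        norm_num)
    rw [← hc] at this
    norm_num [add_dotProduct] at this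
    exact this
  have hint : ∀ g : (Fin d → ℂ) → ℝ, Continuous g → Integrable
      (fun V : Matrix.unitaryGroup (Fin d) ℂ => g ((V : Matrix (Fin d) (Fin d) ℂ) *ᵥ ψ)) μ :=
    fun g hg => integrable_comp_unitary_mulVec_s9 μ hψ hg
  have hn := Complex.continuous_normSq
  have hintp : ∀ u : ℂ, Integrable (fun V : Matrix.unitaryGroup (Fin d) ℂ =>
      Complex.normSq (((V : Matrix (Fin d) (Fin d) ℂ) *ᵥ ψ) i +
        u * ((V : Matrix (Fin d) (Fin d) ℂ) *ᵥ ψ) j) ^ 2) μ := fun u =>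
    hint (fun φ => Complex.normSq (φ i + u * φ j) ^ 2) (by fun_prop)
  have hintd : ∀ l, Integrable (fun V : Matrix.unitaryGroup (Fin d) ℂ =>
      Complex.normSq (((V : Matrix (Fin d) (Fin d) ℂ) *ᵥ ψ) l) ^ 2) μ := fun l =>
    hint (fun φ => Complex.normSq (φ l) ^ 2) (by fun_prop)
  have key : ∀ x y : ℂ, Complex.normSq x * Complex.normSq y = (1 / 16) *
      (Complex.normSq (x + 1 * y) ^ 2 + Complex.normSq (x + -1 * y) ^ 2
        + Complex.normSq (x + Complex.I * y) ^ 2 + Complex.normSq (x + -Complex.I * y) ^ 2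
        - 4 * Complex.normSq x ^ 2 - 4 * Complex.normSq y ^ 2) := fun x y => by
    simp [Complex.normSq_apply]
    ring
  simp_rw [key]
  rw [integral_const_mul, integral_sub, integral_sub, integral_add, integral_add, integral_add,
    integral_const_mul, integral_const_mul, hdiag, hdiag, hpol, hpol, hpol, hpol]
  · ring
  all_goals
    first
    | simp; done
    | exact hintp _
    | exact (hintp _).add (hintp _)
    | exact ((hintp _).add (hintp _)).add (hintp _)
    | exact (((hintp _).add (hintp _)).add (hintp _)).add (hintp _)
    | exact (hintd _).const_mul _
    | exact ((((hintp _).add (hintp _)).add (hintp _)).add (hintp _)).sub ((hintd _).const_mul _)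

/-- The second moment of a diagonal quadratic form of a Haar-random unit vector. -/
theorem integral_sum_mul_normSq_sq [NeZero d] [μ.IsMulLeftInvariant] [IsProbabilityMeasure μ]
    {ψ : Fin d → ℂ} (hψ : star ψ ⬝ᵥ ψ = 1) (l : Fin d → ℝ) :
    ∫ V : Matrix.unitaryGroup (Fin d) ℂ,
        (∑ i, l i * Complex.normSq (((V : Matrix (Fin d) (Fin d) ℂ) *ᵥ ψ) i)) ^ 2 ∂μ =
      ((∑ i, l i) ^ 2 + ∑ i, l i ^ 2) / (d * (d + 1)) := by
  set c := ∫ V : Matrix.unitaryGroup (Fin d) ℂ,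
        Complex.normSq (((V : Matrix (Fin d) (Fin d) ℂ) *ᵥ ψ) 0) ^ 2 ∂μ with hc
  have hn := Complex.continuous_normSq
  have hsum : ∀ l : Fin d → ℝ, ∫ V : Matrix.unitaryGroup (Fin d) ℂ,
        (∑ i, l i * Complex.normSq (((V : Matrix (Fin d) (Fin d) ℂ) *ᵥ ψ) i)) ^ 2 ∂μ =
      c / 2 * ((∑ i, l i) ^ 2 + ∑ i, l i ^ 2) := fun l => by
    have hint : ∀ i j, Integrable (fun V : Matrix.unitaryGroup (Fin d) ℂ => l i * l j *
        (Complex.normSq (((V : Matrix (Fin d) (Fin d) ℂ) *ᵥ ψ) i) *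
          Complex.normSq (((V : Matrix (Fin d) (Fin d) ℂ) *ᵥ ψ) j))) μ := fun i j =>
      integrable_comp_unitary_mulVec_s9 μ hψ
        (g := fun φ => l i * l j * (Complex.normSq (φ i) * Complex.normSq (φ j))) (by fun_prop)
    simp_rw [sq (∑ i, l i * Complex.normSq _), Finset.sum_mul_sum, mul_mul_mul_comm]
    rw [integral_finsetSum _ fun i _ => integrable_finsetSum _ fun j _ => hint i j,
      ← sum_sum_mul_ite_half]
    refine Finset.sum_congr rfl fun i _ => ?_
    rw [integral_finsetSum _ fun j _ => hint i j]
    refine Finset.sum_congr rfl fun j _ => ?_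
    rw [integral_const_mul, integral_normSq_mul_normSq μ hψ 0]
  have h1 := hsum 1
  simp only [Pi.one_apply, one_mul, sum_normSq_unitary_mulVec _ hψ] at h1
  simp at h1
  have hd : (d : ℝ) ≠ 0 := NeZero.ne _
  have hd' : (d : ℝ) + 1 ≠ 0 := by positivity
  rw [hsum, eq_div_iff (mul_ne_zero hd hd')]
  linear_combination (-(∑ i, l i) ^ 2 - ∑ i, l i ^ 2) * h1

/-- The second moment of a Hermitian form of a Haar-random unit vector. -/
theorem integral_re_dotProduct_mulVec_sq [NeZero d] [μ.IsMulLeftInvariant] [IsProbabilityMeasure μ]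
    {ψ : Fin d → ℂ} (hψ : star ψ ⬝ᵥ ψ = 1) {B : Matrix (Fin d) (Fin d) ℂ} (hB : B.IsHermitian) :
    ∫ V : Matrix.unitaryGroup (Fin d) ℂ,
        (star ((V : Matrix (Fin d) (Fin d) ℂ) *ᵥ ψ) ⬝ᵥ
          B *ᵥ ((V : Matrix (Fin d) (Fin d) ℂ) *ᵥ ψ)).re ^ 2 ∂μ =
      (B.trace.re ^ 2 + (B * B).trace.re) / (d * (d + 1)) := by
  set U := hB.eigenvectorUnitary
  set D : Matrix (Fin d) (Fin d) ℂ := diagonal fun i => (hB.eigenvalues i : ℂ) with hD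
  have hBU : B = U * D * star (U : Matrix (Fin d) (Fin d) ℂ) := by
    conv_lhs => rw [hB.spectral_theorem, Unitary.conjStarAlgAut_apply]
    rfl
  have hUU : star (U : Matrix (Fin d) (Fin d) ℂ) * U = 1 := Unitary.coe_star_mul_self U
  have htr : B.trace.re = ∑ i, hB.eigenvalues i := by
    rw [hB.trace_eq_sum_eigenvalues]; simp
  have htr2 : (B * B).trace.re = ∑ i, hB.eigenvalues i ^ 2 := by
    have : B * B = U * (D * D) * star (U : Matrix (Fin d) (Fin d) ℂ) := by
      calc B * B = U * D * (star (U : Matrix (Fin d) (Fin d) ℂ) * U) * D *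
            star (U : Matrix (Fin d) (Fin d) ℂ) := by
            conv_lhs => rw [hBU]
            simp only [Matrix.mul_assoc]
        _ = _ := by rw [hUU]; simp only [Matrix.mul_assoc, Matrix.one_mul]
    rw [this, trace_mul_cycle, hUU, Matrix.one_mul, hD, diagonal_mul_diagonal, trace_diagonal]
    simp [sq]
  have hform : ∀ φ : Fin d → ℂ, (star φ ⬝ᵥ B *ᵥ φ).re = ∑ i, hB.eigenvalues i *
      Complex.normSq ((star (U : Matrix (Fin d) (Fin d) ℂ) *ᵥ φ) i) := fun φ => by
    have : star φ ⬝ᵥ B *ᵥ φ = star (star (U : Matrix (Fin d) (Fin d) ℂ) *ᵥ φ) ⬝ᵥ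
        D *ᵥ (star (U : Matrix (Fin d) (Fin d) ℂ) *ᵥ φ) := by
      conv_lhs => rw [hBU]
      rw [star_mulVec, ← star_eq_conjTranspose, star_star, ← dotProduct_mulVec, mulVec_mulVec,
        mulVec_mulVec, Matrix.mul_assoc]
    rw [this, dotProduct, Complex.re_sum]
    refine Finset.sum_congr rfl fun i _ => ?_
    rw [hD, mulVec_diagonal]
    simp [Complex.normSq_apply]
    ring
  simp_rw [hform]
  rw [htr, htr2, ← integral_sum_mul_normSq_sq μ hψ]
  exact integral_comp_unitary_mulVec_mulVec μ ψ
    (fun φ => (∑ i, hB.eigenvalues i * Complex.normSq (φ i)) ^ 2) (star U).2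

end UnitaryMoments

/-- The variance, over a Haar-random input state `Vψ₀`, of the
change in the classifier's prediction induced by an attack unitary `W`:
`∫ ⟨Vψ₀, (A - W*AW) Vψ₀⟩² dμ(V) = (2/(d+1)) (1 - Re tr(A W* A W)/d)`. -/
theorem stmt9 {d : ℕ} (hd : 2 ≤ d)
    [MeasurableSpace (Matrix.unitaryGroup (Fin d) ℂ)]
    [BorelSpace (Matrix.unitaryGroup (Fin d) ℂ)]
    (μ : Measure (Matrix.unitaryGroup (Fin d) ℂ))
    [μ.IsHaarMeasure] [IsProbabilityMeasure μ]
    (ψ₀ : Fin d → ℂ) (hψ₀ : star ψ₀ ⬝ᵥ ψ₀ = 1)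
    (A : Matrix (Fin d) (Fin d) ℂ)
    (hA : A.IsHermitian) (hAtr : A.trace = 0) (hA2 : A * A = 1)
    (W : Matrix (Fin d) (Fin d) ℂ) (hW : W ∈ Matrix.unitaryGroup (Fin d) ℂ) :
    ∫ V : Matrix.unitaryGroup (Fin d) ℂ,
        ((star ((V : Matrix (Fin d) (Fin d) ℂ).mulVec ψ₀) ⬝ᵥ
            (A - star W * A * W).mulVec ((V : Matrix (Fin d) (Fin d) ℂ).mulVec ψ₀)).re) ^ 2 ∂μ
      = (2 / ((d : ℝ) + 1)) * (1 - (Matrix.trace (A * star W * A * W)).re / d) := by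
  have : NeZero d := ⟨by omega⟩
  have hWW : W * star W = 1 := mem_unitaryGroup_iff.1 hW
  have hWW' : star W * W = 1 := mem_unitaryGroup_iff'.1 hW
  have hB : (A - star W * A * W).IsHermitian := by
    refine hA.sub ?_
    rw [star_eq_conjTranspose]
    exact isHermitian_conjTranspose_mul_mul W hA
  have htr : (A - star W * A * W).trace = 0 := by
    rw [trace_sub, trace_mul_cycle, hWW, Matrix.one_mul, sub_self]
  have hsq : (star W * A * W) * (star W * A * W) = 1 := by
    calc _ = star W * A * (W * star W) * A * W := by simp only [Matrix.mul_assoc]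
      _ = star W * (A * A) * W := by rw [hWW]; simp only [Matrix.mul_assoc, Matrix.one_mul]
      _ = 1 := by rw [hA2, Matrix.mul_one, hWW']
  have htr2 : ((A - star W * A * W) * (A - star W * A * W)).trace =
      2 * d - 2 * (A * star W * A * W).trace := by
    have h1 : (A * (star W * A * W)).trace = (A * star W * A * W).trace := by
      simp only [Matrix.mul_assoc]
    rw [sub_mul, mul_sub, mul_sub, hsq, hA2, trace_sub, trace_sub, trace_sub,
      trace_mul_comm (star W * A * W) A, h1, trace_one, Fintype.card_fin]
    ring
  have hd0 : (d : ℝ) ≠ 0 := NeZero.ne _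
  have hd1 : (d : ℝ) + 1 ≠ 0 := by positivity
  rw [integral_re_dotProduct_mulVec_sq μ hψ₀ hB, htr, htr2]
  simp
  field_simp
end
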